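/- arXiv:2304.08612 — 4 statements merged into one kernel-verified Lean document; each statement's English description precedes it below -/
import Mathlib

section
/- The straight-through estimator is unbiased for the first-order approximation of the gradient: for every k, Σ_{c=1}^n π_c · ST(I_c)_k = Σ_{i=1}^n Σ_{j=1}^n π_j · ⟨∇f(I_j), I_i − I_j⟩ · π_i (δ_{ik} − π_k), where ST(D)_k = Σ_{j=1}^n (∇f(D))_j · π_j (δ_{jk} − π_k); i.e., in expectation over D, the straight-through estimator equals the estimator obtained from the exact identity ∂L/∂θ_k = Σ_i Σ_j π_j (f(I_i) − f(I_j)) π_i(δ_{ik} − π_k) by replacing each difference f(I_i) − f(I_j) with its first-order approximation ⟨∇f(I_j), I_i − I_j⟩. -/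
/-- The softmax function on `ℝⁿ`: `softmax θ i = exp (θ i) / ∑ j, exp (θ j)`. -/
noncomputable def softmax {n : ℕ} (θ : Fin n → ℝ) : Fin n → ℝ :=
  fun i => Real.exp (θ i) / ∑ j, Real.exp (θ j)

/-- The `i`-th one-hot (standard basis) vector of `ℝⁿ`. -/
def oneHot {n : ℕ} (i : Fin n) : Fin n → ℝ := Pi.single i 1

/-- The straight-through estimator at the one-hot vector `D`:
`ST(D)_k = ∑ j, (∇f(D))_j * π_j * (δ_{jk} − π_k)`, where `(∇f(D))_j` is the `j`-th partial
derivative of `f` at `D` and `π = softmax θ`. -/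
noncomputable def STEst {n : ℕ} (θ : Fin n → ℝ) (f : (Fin n → ℝ) → ℝ)
    (D : Fin n → ℝ) (k : Fin n) : ℝ :=
  ∑ j, fderiv ℝ f D (oneHot j) *
    (softmax θ j * ((if j = k then (1 : ℝ) else 0) - softmax θ k))

/-- The straight-through estimator is unbiased for the first-order approximation of the
gradient: in expectation over `D` with `P(D = I c) = π c`, `ST(D)_k` equals the estimator
obtained from the exact identity by replacing `f(I i) − f(I j)` with its first-order
approximation `⟨∇f(I j), I i − I j⟩`. -/
theorem st_unbiased_first_order {n : ℕ} (hn : 1 ≤ n) (θ : Fin n → ℝ)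
    (f : (Fin n → ℝ) → ℝ) (hf : Differentiable ℝ f) (k : Fin n) :
    ∑ c, softmax θ c * STEst θ f (oneHot c) k =
      ∑ i, ∑ j, softmax θ j * fderiv ℝ f (oneHot j) (oneHot i - oneHot j) *
        (softmax θ i * ((if i = k then (1 : ℝ) else 0) - softmax θ k)) := by
  have hpos : 0 < ∑ j, Real.exp (θ j) :=
    Finset.sum_pos (fun j _ => Real.exp_pos _) ⟨k, Finset.mem_univ k⟩
  have hsum : ∑ i, softmax θ i = 1 := by
    simp only [softmax]
    rw [← Finset.sum_div]
    exact div_self hpos.ne'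
  have hzero : ∑ i, softmax θ i * ((if i = k then (1 : ℝ) else 0) - softmax θ k) = 0 := by
    simp only [mul_sub, Finset.sum_sub_distrib, ← Finset.sum_mul, hsum]
    simp
  rw [Finset.sum_comm]
  refine Finset.sum_congr rfl fun c _ => ?_
  simp only [map_sub, mul_sub (softmax θ c), sub_mul (softmax θ c * _),
    Finset.sum_sub_distrib, ← Finset.mul_sum, hzero, mul_zero, sub_zero]
  simp only [STEst, Finset.mul_sum, mul_assoc]
end

section
/- (Theorem: unbiasedness of ReinMax for the second-order approximation.) For every k, Σ_{c=1}^n π_c · ReinMax(I_c)_k = Σ_{i=1}^n Σ_{j=1}^n (π_j / 2) · ⟨∇f(I_i) + ∇f(I_j), I_i − I_j⟩ · π_i (δ_{ik} − π_k); i.e., in expectation over the one-hot sample D, the ReinMax estimator equals the second-order (Heun's method) approximation of the exact gradient ∂L/∂θ_k = Σ_i Σ_j π_j (f(I_i) − f(I_j)) π_i(δ_{ik} − π_k), obtained by replacing each difference f(I_i) − f(I_j) with (1/2)⟨∇f(I_i) + ∇f(I_j), I_i − I_j⟩. -/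
/-- The estimator `∇̂^p(D)_k = ∑ j, (∇f(D))_j * p_j * (δ_{jk} − p_k)` for a
probability-like vector `p`, where `(∇f(D))_j` is the `j`-th partial derivative of `f`. -/
noncomputable def gradEst {n : ℕ} (f : (Fin n → ℝ) → ℝ) (p : Fin n → ℝ)
    (D : Fin n → ℝ) (k : Fin n) : ℝ :=
  ∑ j, fderiv ℝ f D (oneHot j) * (p j * ((if j = k then (1 : ℝ) else 0) - p k))

/-- The ReinMax estimator `ReinMax(D) = 2 ∇̂^{(π+D)/2}(D) − (1/2) ∇̂^π(D)`,
where `π = softmax θ` and `(π+D)/2` is the coordinatewise average. -/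
noncomputable def reinMax {n : ℕ} (θ : Fin n → ℝ) (f : (Fin n → ℝ) → ℝ)
    (D : Fin n → ℝ) (k : Fin n) : ℝ :=
  2 * gradEst f (fun j => (softmax θ j + D j) / 2) D k - (1 / 2) * gradEst f (softmax θ) D k

/-- Closed form of the ReinMax estimator at a one-hot vector. -/
lemma reinMax_oneHot {n : ℕ} (θ : Fin n → ℝ) (f : (Fin n → ℝ) → ℝ) (c k : Fin n) :
    reinMax θ f (oneHot c) k =
      softmax θ k * fderiv ℝ f (oneHot c) (oneHot k) / 2
      - (if c = k then (1 : ℝ) else 0) / 2 *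
          (∑ j, softmax θ j * fderiv ℝ f (oneHot c) (oneHot j))
      + (if c = k then (1 : ℝ) else 0) * fderiv ℝ f (oneHot c) (oneHot c) / 2
      - softmax θ k * fderiv ℝ f (oneHot c) (oneHot c) / 2 := by
  unfold reinMax gradEst
  generalize softmax θ = p
  have hD : ∀ j : Fin n, (oneHot c : Fin n → ℝ) j = if c = j then (1 : ℝ) else 0 := by
    intro j
    simp [oneHot, Pi.single_apply, eq_comm]
  generalize hG : (fun j => fderiv ℝ f (oneHot c) (oneHot j)) = G
  have hG' : ∀ j, fderiv ℝ f (oneHot c) (oneHot j) = G j := fun j => by rw [← hG]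
  simp only [hG', hD]
  have e1 : p k * G k / 2 = ∑ j, if j = k then p j * G j / 2 else 0 := by simp
  have e2 : (if c = k then (1 : ℝ) else 0) * G c / 2
      = ∑ j, if c = j then (if c = k then (1 : ℝ) else 0) * G j / 2 else 0 := by
    rw [Finset.sum_ite_eq]; simp
  have e3 : p k * G c / 2 = ∑ j, if c = j then p k * G j / 2 else 0 := by simp
  rw [e1, e2, e3, Finset.mul_sum, Finset.mul_sum, Finset.mul_sum, ← Finset.sum_sub_distrib,
    ← Finset.sum_sub_distrib, ← Finset.sum_add_distrib, ← Finset.sum_sub_distrib]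
  refine Finset.sum_congr rfl fun j _ => ?_
  by_cases h1 : c = j
  · subst h1
    by_cases h2 : c = k
    · simp only [h2, if_true]; ring
    · simp only [h2, if_true, if_false]; ring
  · by_cases h2 : c = k
    · subst h2
      have h3 : ¬ j = c := fun h => h1 h.symm
      simp only [h1, h3, if_true, if_false]; ring
    · by_cases h3 : j = k
      · simp only [h1, h2, h3, if_true, if_false]; ring
      · simp only [h1, h2, h3, if_false]; ring

/-- Unbiasedness of ReinMax for the second-order approximation: in expectation over the
one-hot sample `D` with `P(D = I c) = π c`, the ReinMax estimator equals the second-order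
(Heun's method) approximation of the exact gradient, obtained by replacing each difference
`f(I i) − f(I j)` with `(1/2)⟨∇f(I i) + ∇f(I j), I i − I j⟩`. -/
theorem reinmax_unbiased_second_order {n : ℕ} (hn : 1 ≤ n) (θ : Fin n → ℝ)
    (f : (Fin n → ℝ) → ℝ) (hf : Differentiable ℝ f) (k : Fin n) :
    ∑ c, softmax θ c * reinMax θ f (oneHot c) k =
      ∑ i, ∑ j, softmax θ j / 2 *
        (fderiv ℝ f (oneHot i) (oneHot i - oneHot j) +
          fderiv ℝ f (oneHot j) (oneHot i - oneHot j)) *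
        (softmax θ i * ((if i = k then (1 : ℝ) else 0) - softmax θ k)) := by
  have hsum : ∑ j, softmax θ j = 1 := by
    unfold softmax
    rw [← Finset.sum_div]
    refine div_self (ne_of_gt ?_)
    exact Finset.sum_pos (fun i _ => Real.exp_pos _) ⟨k, Finset.mem_univ k⟩
  simp only [reinMax_oneHot, map_sub]
  generalize softmax θ = p at *
  generalize hG : (fun i j : Fin n => fderiv ℝ f (oneHot i) (oneHot j)) = G
  have hG' : ∀ i j, fderiv ℝ f (oneHot i) (oneHot j) = G i j := fun i j => by rw [← hG]
  simp only [hG']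
  have anti : ∑ i, ∑ j, p i * p j * (G i i - G i j + (G j i - G j j)) = 0 := by
    have h : ∑ i, ∑ j, p i * p j * (G i i - G i j + (G j i - G j j))
        = - ∑ i, ∑ j, p i * p j * (G i i - G i j + (G j i - G j j)) := by
      conv_lhs => rw [Finset.sum_comm]
      simp only [← Finset.sum_neg_distrib]
      refine Finset.sum_congr rfl fun i _ => Finset.sum_congr rfl fun j _ => ?_
      ring
    linarith
  have hR : ∑ i, ∑ j, p j / 2 * (G i i - G i j + (G j i - G j j)) *
        (p i * ((if i = k then (1 : ℝ) else 0) - p k))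
      = ∑ j, p k * p j / 2 * (G k k - G k j + (G j k - G j j)) := by
    have h1 : ∑ j, p k * p j / 2 * (G k k - G k j + (G j k - G j j))
        = ∑ i, if i = k then ∑ j, p i * p j / 2 * (G i i - G i j + (G j i - G j j)) else 0 := by
      simp
    have h0 : ∀ x : ℝ, x = x - p k / 2 *
        ∑ i, ∑ j, p i * p j * (G i i - G i j + (G j i - G j j)) := by
      intro x; rw [anti]; ring
    rw [h1, h0 (∑ i, if i = k then _ else _), Finset.mul_sum, ← Finset.sum_sub_distrib]
    refine Finset.sum_congr rfl fun i _ => ?_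
    by_cases h : i = k
    · simp only [h, if_true]
      rw [Finset.mul_sum, ← Finset.sum_sub_distrib]
      exact Finset.sum_congr rfl fun j _ => by ring
    · simp only [h, if_false, zero_sub]
      rw [Finset.mul_sum, ← Finset.sum_neg_distrib]
      exact Finset.sum_congr rfl fun j _ => by ring
  rw [hR]
  have hd : ∀ F : Fin n → ℝ, ∑ c, (if c = k then (1 : ℝ) else 0) * F c = F k := by
    intro F; simp
  have hL : ∀ c, p c * (p k * G c k / 2 - (if c = k then (1 : ℝ) else 0) / 2 * (∑ j, p j * G c j)
        + (if c = k then (1 : ℝ) else 0) * G c c / 2 - p k * G c c / 2)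
      = (if c = k then (1 : ℝ) else 0) * (p c / 2 * (G c c - ∑ j, p j * G c j))
        + p k * p c / 2 * (G c k - G c c) := fun c => by ring
  simp only [hL]
  rw [Finset.sum_add_distrib, hd]
  have h2 : p k / 2 * (G k k - ∑ j, p j * G k j) = ∑ j, p k * p j / 2 * (G k k - G k j) := by
    have : G k k = ∑ j, p j * G k k := by rw [← Finset.sum_mul, hsum, one_mul]
    conv_lhs => rw [this]
    rw [← Finset.sum_sub_distrib, Finset.mul_sum]
    exact Finset.sum_congr rfl fun j _ => by ring
  rw [h2, ← Finset.sum_add_distrib]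
  exact Finset.sum_congr rfl fun j _ => by ring
end

section
/- (Remark: ReinMax is unbiased for the baseline-free second-order approximation.) For every k, Σ_{c=1}^n π_c · ReinMax(I_c)_k = π_k · Σ_{i=1}^n π_i · (1/2)⟨∇f(I_i) + ∇f(I_k), I_k − I_i⟩; i.e., in expectation over the one-hot sample D, the ReinMax estimator equals the second-order approximation of the baseline-free exact gradient identity ∂L/∂θ_k = π_k Σ_i π_i (f(I_k) − f(I_i)), obtained by replacing each difference f(I_k) − f(I_i) with (1/2)⟨∇f(I_i) + ∇f(I_k), I_k − I_i⟩. -/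
lemma softmax_sum_one {n : ℕ} (hn : 1 ≤ n) (θ : Fin n → ℝ) : ∑ i, softmax θ i = 1 := by
  have : Nonempty (Fin n) := ⟨⟨0, hn⟩⟩
  unfold softmax
  rw [← Finset.sum_div]
  exact div_self (Finset.sum_pos (fun i _ => Real.exp_pos _) Finset.univ_nonempty).ne'

lemma gradEst_eq {n : ℕ} (f : (Fin n → ℝ) → ℝ) (p D : Fin n → ℝ) (k : Fin n) :
    gradEst f p D k = p k * fderiv ℝ f D (oneHot k)
      - p k * ∑ j, p j * fderiv ℝ f D (oneHot j) := by
  unfold gradEst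
  simp only [mul_sub, Finset.sum_sub_distrib, mul_ite, mul_one, mul_zero, Finset.sum_ite_eq',
    Finset.mem_univ, if_true, Finset.mul_sum]
  rw [mul_comm]
  congr 1
  exact Finset.sum_congr rfl fun j _ => by ring

lemma reinMax_eq {n : ℕ} (θ : Fin n → ℝ) (f : (Fin n → ℝ) → ℝ) (c k : Fin n) :
    reinMax θ f (oneHot c) k =
      softmax θ k / 2 * (fderiv ℝ f (oneHot c) (oneHot k) - fderiv ℝ f (oneHot c) (oneHot c))
      + if c = k then (fderiv ℝ f (oneHot k) (oneHot k)
          - ∑ j, softmax θ j * fderiv ℝ f (oneHot k) (oneHot j)) / 2 else 0 := by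
  have h : ∑ j, (softmax θ j + (oneHot c : Fin n → ℝ) j) / 2 * fderiv ℝ f (oneHot c) (oneHot j)
      = ((∑ j, softmax θ j * fderiv ℝ f (oneHot c) (oneHot j))
        + fderiv ℝ f (oneHot c) (oneHot c)) / 2 := by
    have h2 : ∑ j, (oneHot c : Fin n → ℝ) j * fderiv ℝ f (oneHot c) (oneHot j)
        = fderiv ℝ f (oneHot c) (oneHot c) := by
      rw [Finset.sum_eq_single c]
      · simp [oneHot]
      · intro b _ hb
        simp [oneHot, hb]
      · simp
    rw [← h2, ← Finset.sum_add_distrib, Finset.sum_div]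
    exact Finset.sum_congr rfl fun j _ => by ring
  unfold reinMax
  rw [gradEst_eq, gradEst_eq, h]
  by_cases hc : c = k
  · subst hc
    have : (oneHot c : Fin n → ℝ) c = 1 := by simp [oneHot]
    rw [this, if_pos rfl]
    ring
  · have : (oneHot c : Fin n → ℝ) k = 0 := by simp [oneHot, Ne.symm hc]
    rw [this, if_neg hc]
    ring

/-- ReinMax is unbiased for the baseline-free second-order approximation: in expectation
over the one-hot sample `D` with `P(D = I c) = π c`, the ReinMax estimator equals
`π_k * ∑ i, π_i * (1/2)⟨∇f(I i) + ∇f(I k), I k − I i⟩`, the second-order approximation of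
the baseline-free exact gradient identity `∂L/∂θ_k = π_k ∑ i, π_i (f(I k) − f(I i))`. -/
theorem reinmax_unbiased_second_order_baseline_free {n : ℕ} (hn : 1 ≤ n) (θ : Fin n → ℝ)
    (f : (Fin n → ℝ) → ℝ) (hf : Differentiable ℝ f) (k : Fin n) :
    ∑ c, softmax θ c * reinMax θ f (oneHot c) k =
      softmax θ k * ∑ i, softmax θ i * (1 / 2 *
        (fderiv ℝ f (oneHot i) (oneHot k - oneHot i) +
          fderiv ℝ f (oneHot k) (oneHot k - oneHot i))) := by
  simp only [reinMax_eq, mul_add, Finset.sum_add_distrib, mul_ite, mul_zero, Finset.sum_ite_eq',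
    Finset.mem_univ, if_true, map_sub]
  congr 1
  · rw [Finset.mul_sum]
    exact Finset.sum_congr rfl fun j _ => by ring
  · have h : ∑ i, softmax θ i * (1 / 2 * (fderiv ℝ f (oneHot k) (oneHot k)
        - fderiv ℝ f (oneHot k) (oneHot i)))
        = ((∑ i, softmax θ i) * fderiv ℝ f (oneHot k) (oneHot k)
          - ∑ j, softmax θ j * fderiv ℝ f (oneHot k) (oneHot j)) / 2 := by
      rw [Finset.sum_mul, ← Finset.sum_sub_distrib, Finset.sum_div]
      exact Finset.sum_congr rfl fun j _ => by ring
    rw [h, softmax_sum_one hn, one_mul]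
end

section
/- (Remark: reweighted straight-through with a general baseline.) Let φ ∈ ℝ^n. Then for every k, Σ_{c=1}^n π_c · (φ_c / π_c) · ST(I_c)_k = Σ_{i=1}^n Σ_{j=1}^n φ_j · ⟨∇f(I_j), I_i − I_j⟩ · π_i (δ_{ik} − π_k); i.e., the straight-through estimator reweighted by the ratio φ_{c(D)} / π_{c(D)} (where c(D) is the sampled category, and π_c > 0 since π is a softmax output) is, in expectation over D, equal to the first-order approximation of the gradient obtained using Σ_i φ_i f(I_i) as the baseline and approximating f(I_i) − f(I_j) by ⟨∇f(I_j), I_i − I_j⟩. -/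
/-- Reweighted straight-through with a general baseline: the straight-through estimator
reweighted by `φ_{c(D)} / π_{c(D)}` is, in expectation over `D` with `P(D = I c) = π c`,
equal to the first-order approximation of the gradient obtained using `∑ i, φ_i f(I i)` as
the baseline and approximating `f(I i) − f(I j)` by `⟨∇f(I j), I i − I j⟩`. -/
theorem reweighted_st_general_baseline {n : ℕ} (hn : 1 ≤ n) (θ : Fin n → ℝ)
    (φ : Fin n → ℝ) (f : (Fin n → ℝ) → ℝ) (hf : Differentiable ℝ f) (k : Fin n) :
    ∑ c, softmax θ c * (φ c / softmax θ c * STEst θ f (oneHot c) k) =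
      ∑ i, ∑ j, φ j * fderiv ℝ f (oneHot j) (oneHot i - oneHot j) *
        (softmax θ i * ((if i = k then (1 : ℝ) else 0) - softmax θ k)) := by
  have hS : 0 < ∑ j, Real.exp (θ j) :=
    Finset.sum_pos (fun j _ => Real.exp_pos _) ⟨k, Finset.mem_univ k⟩
  have hpos : ∀ c, softmax θ c ≠ 0 := fun c => (div_pos (Real.exp_pos _) hS).ne'
  have hsum : ∑ c, softmax θ c = 1 := by
    simp only [softmax]
    rw [← Finset.sum_div, div_self hS.ne']
  have hzero : ∑ i, softmax θ i * ((if i = k then (1 : ℝ) else 0) - softmax θ k) = 0 := by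
    simp only [mul_sub, Finset.sum_sub_distrib, ← Finset.sum_mul, hsum]
    simp
  rw [Finset.sum_comm]
  refine Finset.sum_congr rfl fun c _ => ?_
  have h1 : softmax θ c * (φ c / softmax θ c * STEst θ f (oneHot c) k)
      = φ c * STEst θ f (oneHot c) k := by
    have := hpos c
    field_simp
  have h2 : ∀ i, φ c * fderiv ℝ f (oneHot c) (oneHot i - oneHot c) *
        (softmax θ i * ((if i = k then (1 : ℝ) else 0) - softmax θ k))
      = φ c * (fderiv ℝ f (oneHot c) (oneHot i) *
          (softmax θ i * ((if i = k then (1 : ℝ) else 0) - softmax θ k)))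
        - φ c * fderiv ℝ f (oneHot c) (oneHot c) *
          (softmax θ i * ((if i = k then (1 : ℝ) else 0) - softmax θ k)) := by
    intro i
    rw [map_sub]
    ring
  rw [h1, Finset.sum_congr rfl fun i _ => h2 i, Finset.sum_sub_distrib, ← Finset.mul_sum,
    ← Finset.mul_sum, hzero, mul_zero, sub_zero, STEst]
end
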